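/- For all integers m and n with 4 ≤ m ≤ n, both m and n even, and (m, n) ≠ (4, 4), the two-color Ramsey number of cycles satisfies R(C_m, C_n) = n − 1 + m/2. -/

import Mathlib

open SimpleGraph

/-- Every red/blue coloring of the edges of `K_N` (red = `0`, blue = `1`) contains a red
copy of `G` or a blue copy of `H`. -/
def RamseyProp {V W : Type*} (G : SimpleGraph V) (H : SimpleGraph W) (N : ℕ) : Prop :=
  ∀ c : Sym2 (Fin N) → Fin 2,
    (∃ f : V ↪ Fin N, ∀ u v, G.Adj u v → c s(f u, f v) = 0) ∨
    (∃ f : W ↪ Fin N, ∀ u v, H.Adj u v → c s(f u, f v) = 1)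

/-- The two-color Ramsey number `R(G, H)`: the minimum `N` such that every red/blue
coloring of the edges of `K_N` contains a red copy of `G` or a blue copy of `H`. -/
noncomputable def ramseyNumber {V W : Type*} (G : SimpleGraph V) (H : SimpleGraph W) : ℕ :=
  sInf {N | RamseyProp G H N}


/-- `G` contains a cycle of length `r`. -/
def HasCyc {V : Type*} (G : SimpleGraph V) (r : ℕ) : Prop :=
  ∃ f : ZMod r → V, Function.Injective f ∧ ∀ i, G.Adj (f i) (f (i + 1))

theorem hasCyc_of_nat {V : Type*} {G : SimpleGraph V} {r : ℕ} (hr : 2 ≤ r) (g : ℕ → V)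
    (inj : ∀ i < r, ∀ j < r, g i = g j → i = j)
    (adj : ∀ i, i + 1 < r → G.Adj (g i) (g (i + 1))) (close : G.Adj (g (r - 1)) (g 0)) :
    HasCyc G r := by
  have : NeZero r := ⟨by omega⟩
  have : Fact (1 < r) := ⟨by omega⟩
  refine ⟨fun i => g i.val, ?_, ?_⟩
  · intro i j h
    exact ZMod.val_injective r (inj _ (ZMod.val_lt i) _ (ZMod.val_lt j) h)
  · intro i
    have hi := ZMod.val_lt i
    show G.Adj (g i.val) (g (i + 1).val)
    have h1 : (1 : ZMod r).val = 1 := ZMod.val_one r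
    by_cases h : i.val + 1 < r
    · rw [ZMod.val_add_of_lt (by rw [h1]; exact h), h1]
      exact adj _ h
    · have h2 : (i + 1).val = 0 := by
        rw [ZMod.val_add, h1]
        have : i.val + 1 = r := by omega
        rw [this, Nat.mod_self]
      have h3 : i.val = r - 1 := by omega
      rw [h2, h3]; exact close

theorem hasCyc_of_list {V : Type*} {G : SimpleGraph V} (a : V) (L : List V)
    (hL : 1 ≤ L.length) (hn : (a :: L).Nodup) (hc : List.IsChain G.Adj (a :: (L ++ [a]))) :
    HasCyc G (L.length + 1) := by
  rw [List.isChain_iff_getElem] at hc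
  refine hasCyc_of_nat (by omega) (fun i => (a :: L).getD i a) ?_ ?_ ?_
  · intro i hi j hj h
    have hi' : i < (a :: L).length := by simpa using hi
    have hj' : j < (a :: L).length := by simpa using hj
    simp only [List.getD_eq_getElem _ _ hi', List.getD_eq_getElem _ _ hj'] at h
    exact (List.Nodup.getElem_inj_iff hn).1 h
  · intro i hi
    have := hc i (by simp; omega)
    have hi' : i < (a :: L).length := by simp; omega
    have hj' : i + 1 < (a :: L).length := by simp; omega
    simp only [List.getD_eq_getElem _ _ hi', List.getD_eq_getElem _ _ hj']
    have e : a :: (L ++ [a]) = (a :: L) ++ [a] := by simp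
    simp only [e] at this
    rwa [List.getElem_append_left hi', List.getElem_append_left hj'] at this
  · have := hc L.length (by simp)
    have hi' : L.length < (a :: L).length := by simp
    have e : a :: (L ++ [a]) = (a :: L) ++ [a] := by simp
    simp only [e] at this
    rw [List.getElem_append_left hi', List.getElem_append_right (by simp)] at this
    simp only [Nat.add_sub_cancel, List.getD_eq_getElem _ _ hi']
    simpa using this

/-- The arithmetic segment `x a, x (a+d), …` with `s` terms. -/
def seg {V : Type*} {M : ℕ} (x : ZMod M → V) (d : ZMod M) : ℕ → ZMod M → List V
  | 0, _ => []
  | s + 1, a => x a :: seg x d s (a + d)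

theorem seg_length {V : Type*} {M : ℕ} (x : ZMod M → V) (d : ZMod M) (s : ℕ) (a : ZMod M) :
    (seg x d s a).length = s := by
  induction s generalizing a with
  | zero => rfl
  | succ s ih => simp [seg, ih]

theorem mem_seg {V : Type*} {M : ℕ} {x : ZMod M → V} {d : ZMod M} {s : ℕ} {a : ZMod M} {v : V} :
    v ∈ seg x d s a ↔ ∃ t : ℕ, t < s ∧ v = x (a + d * t) := by
  induction s generalizing a with
  | zero => simp [seg]
  | succ s ih =>
    simp only [seg, List.mem_cons, ih]
    constructor
    · rintro (rfl | ⟨t, ht, rfl⟩)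
      · exact ⟨0, by omega, by simp⟩
      · exact ⟨t + 1, by omega, by push_cast; ring_nf⟩
    · rintro ⟨t, ht, rfl⟩
      rcases t with _ | t
      · left; simp
      · right; exact ⟨t, by omega, by push_cast; ring_nf⟩

theorem seg_nodup {V : Type*} {M : ℕ} {x : ZMod M → V} (hx : Function.Injective x)
    {d : ZMod M} {s : ℕ} {a : ZMod M}
    (hd : ∀ t t' : ℕ, t < s → t' < s → d * (t : ZMod M) = d * t' → t = t') :
    (seg x d s a).Nodup := by
  induction s generalizing a with
  | zero => simp [seg]
  | succ s ih =>
    rw [seg, List.nodup_cons]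
    refine ⟨?_, ih fun t t' h h' => hd t t' (by omega) (by omega)⟩
    rw [mem_seg]
    rintro ⟨t, ht, h⟩
    have h := hx h
    have := hd 0 (t + 1) (by omega) (by omega) (by
      push_cast
      have h2 : a + 0 = a + (d + d * t) := by rw [add_zero, ← add_assoc]; exact h
      have := add_left_cancel h2
      rw [mul_zero, this]; ring)
    omega

theorem seg_chain {V : Type*} {M : ℕ} {G : SimpleGraph V} {x : ZMod M → V} {d : ZMod M}
    (hd : ∀ i, G.Adj (x i) (x (i + d))) (v : V) (L : List V) {s : ℕ} (hs : 1 ≤ s)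
    {a b : ZMod M} (hb : b = a + d * ((s - 1 : ℕ) : ZMod M))
    (hv : G.Adj (x b) v) (hL : List.IsChain G.Adj (v :: L)) (u : V) (hu : G.Adj u (x a)) :
    List.IsChain G.Adj (u :: (seg x d s a ++ v :: L)) := by
  induction s generalizing a u with
  | zero => omega
  | succ s ih =>
    rw [seg, List.cons_append, List.isChain_cons_cons]
    refine ⟨hu, ?_⟩
    rcases s with _ | s
    · simp only [seg, List.nil_append, List.isChain_cons_cons]
      refine ⟨?_, hL⟩
      simp at hb; rwa [← hb]
    · refine ih (by omega) ?_ _ (hd a)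
      rw [hb]; simp; ring

theorem cast_inj_of_lt {M : ℕ} {t t' : ℕ} (h : t < M) (h' : t' < M)
    (e : (t : ZMod M) = t') : t = t' := by
  rw [ZMod.natCast_eq_natCast_iff'] at e
  rwa [Nat.mod_eq_of_lt h, Nat.mod_eq_of_lt h'] at e

/-- Initial run of one or two outside vertices, then a segment -/
theorem cyc_one {V : Type*} {M : ℕ} {G : SimpleGraph V} {x : ZMod M → V}
    (hx : Function.Injective x) {d : ZMod M} {s : ℕ} (hs : 1 ≤ s) {a b : ZMod M}
    (hd : ∀ t t' : ℕ, t < s → t' < s → d * (t : ZMod M) = d * t' → t = t')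
    (hG : ∀ i, G.Adj (x i) (x (i + d))) (hb : b = a + d * ((s - 1 : ℕ) : ZMod M))
    {y : V} (hy : ∀ i, x i ≠ y) (h1 : G.Adj y (x a)) (h2 : G.Adj y (x b)) : HasCyc G (s + 1) := by
  have := hasCyc_of_list (G := G) y (seg x d s a) (by rw [seg_length]; exact hs) ?_ ?_
  · rwa [seg_length] at this
  · rw [List.nodup_cons]
    refine ⟨?_, seg_nodup hx hd⟩
    rw [mem_seg]; rintro ⟨t, -, h⟩; exact hy _ h.symm
  · exact seg_chain hG y [] hs hb h2.symm (by simp) y h1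

theorem cyc_two {V : Type*} {M : ℕ} {G : SimpleGraph V} {x : ZMod M → V}
    (hx : Function.Injective x) {d : ZMod M} {s : ℕ} (hs : 1 ≤ s) {a b : ZMod M}
    (hd : ∀ t t' : ℕ, t < s → t' < s → d * (t : ZMod M) = d * t' → t = t')
    (hG : ∀ i, G.Adj (x i) (x (i + d))) (hb : b = a + d * ((s - 1 : ℕ) : ZMod M))
    {y y' : V} (hy : ∀ i, x i ≠ y) (hy' : ∀ i, x i ≠ y') (hyy : G.Adj y y')
    (h1 : G.Adj y' (x a)) (h2 : G.Adj y (x b)) : HasCyc G (s + 2) := by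
  have := hasCyc_of_list (G := G) y (y' :: seg x d s a) (by simp) ?_ ?_
  · simpa [seg_length] using this
  · rw [List.nodup_cons, List.nodup_cons, List.mem_cons]
    refine ⟨?_, ?_, seg_nodup hx hd⟩
    · rintro (h | h)
      · exact hyy.ne h
      · rw [mem_seg] at h; obtain ⟨t, -, h⟩ := h; exact hy _ h.symm
    · rw [mem_seg]; rintro ⟨t, -, h⟩; exact hy' _ h.symm
  · rw [List.cons_append, List.isChain_cons_cons]
    exact ⟨hyy, seg_chain hG y [] hs hb h2.symm (by simp) y' h1⟩

/-- A chord of distance two shortens a cycle by one. -/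
theorem cyc_shorten {V : Type*} {M : ℕ} (hM : 4 ≤ M) {G : SimpleGraph V} {x : ZMod M → V}
    (hx : Function.Injective x) (hG : ∀ i, G.Adj (x i) (x (i + 1)))
    {i : ZMod M} (h : G.Adj (x i) (x (i + 2))) : HasCyc G (M - 1) := by
  have := hasCyc_of_list (G := G) (x i) (seg x 1 (M - 2) (i + 2))
    (by rw [seg_length]; omega) ?_ ?_
  · rw [seg_length] at this
    convert this using 1; omega
  · rw [List.nodup_cons]
    refine ⟨?_, seg_nodup hx ?_⟩
    · rw [mem_seg]
      rintro ⟨t, ht, h⟩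
      have h := hx h
      have h2 : ((0 : ℕ) : ZMod M) = ((t + 2 : ℕ) : ZMod M) := by
        push_cast
        have : i + 0 = i + (t + 2) := by rw [add_zero]; linear_combination h
        exact add_left_cancel this
      have := cast_inj_of_lt (by omega) (by omega) h2
      omega
    · intro t t' ht ht' e
      simp only [one_mul] at e
      exact cast_inj_of_lt (by omega) (by omega) e
  · have hM0 : (M : ZMod M) = 0 := ZMod.natCast_self M
    refine seg_chain hG (x i) [] (s := M - 2) (a := i + 2) (b := i - 1) (by omega) ?_ ?_ (by simp)
      _ h
    · have : M - 2 - 1 = M - 3 := by omega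
      rw [this, Nat.cast_sub (by omega), hM0]; push_cast; ring
    · have := hG (i - 1); rwa [sub_add_cancel] at this

theorem cross_arith {M s : ℕ} (hsM : s < M) {t u : ℕ} (ht : t < s) (hu : u < M - s) {j : ZMod M}
    (h : j + (-1) * (t : ZMod M) = j + 1 + 1 * (u : ZMod M)) : False := by
  have h2 : ((0 : ℕ) : ZMod M) = ((t + u + 1 : ℕ) : ZMod M) := by
    push_cast
    have : j + 0 = j + (t + u + 1) := by linear_combination h
    exact add_left_cancel this
  have := cast_inj_of_lt (by omega) (by omega) h2
  omega

/-- Rerouting through `y` between `x i`, `x j`, and through `mid` between `x (i+1)`, `x (j+1)`. -/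
theorem cyc_cross {V : Type*} {M : ℕ} [NeZero M] {G : SimpleGraph V} {x : ZMod M → V}
    (hx : Function.Injective x) (hG : ∀ i, G.Adj (x i) (x (i + 1)))
    {i j : ZMod M} (hij : i ≠ j) {y : V} (hy : ∀ i, x i ≠ y)
    (h1 : G.Adj y (x i)) (h2 : G.Adj y (x j)) :
    (G.Adj (x (i + 1)) (x (j + 1)) → HasCyc G (M + 1)) ∧
    (∀ y', (∀ i, x i ≠ y') → y ≠ y' → G.Adj y' (x (i + 1)) → G.Adj y' (x (j + 1)) →
      HasCyc G (M + 2)) := by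
  have hM0 : (M : ZMod M) = 0 := ZMod.natCast_self M
  obtain ⟨s, hs, hs0, hsM⟩ : ∃ s : ℕ, ((s : ZMod M) = j - i) ∧ 1 ≤ s ∧ s < M := by
    refine ⟨(j - i).val, ZMod.natCast_zmod_val _, ?_, ZMod.val_lt _⟩
    rw [Nat.one_le_iff_ne_zero, Ne, ZMod.val_eq_zero, sub_eq_zero]
    exact fun h => hij h.symm
  have hG' : ∀ i, G.Adj (x i) (x (i + (-1))) := by
    intro i
    have := (hG (i + (-1))).symm
    rwa [neg_add_cancel_right] at this
  have n1 : (seg x (-1) s j).Nodup := seg_nodup hx (by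
    intro t t' ht ht' e
    simp only [neg_mul, one_mul, neg_inj] at e
    exact cast_inj_of_lt (by omega) (by omega) e)
  have n2 : (seg x 1 (M - s) (j + 1)).Nodup := seg_nodup hx (by
    intro t t' ht ht' e
    simp only [one_mul] at e
    exact cast_inj_of_lt (by omega) (by omega) e)
  have hdis : ∀ v, v ∈ seg x (-1) s j → v ∈ seg x 1 (M - s) (j + 1) → False := by
    intro v hv hv'
    rw [mem_seg] at hv hv'
    obtain ⟨t, ht, rfl⟩ := hv
    obtain ⟨u, hu, h⟩ := hv'
    exact cross_arith hsM ht hu (hx h)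
  have hy1 : ∀ y, (∀ i, x i ≠ y) → ∀ d s a, y ∉ seg x d s a := by
    intro y hy d s a h
    rw [mem_seg] at h; obtain ⟨t, -, h⟩ := h; exact hy _ h.symm
  have eP : i + 1 = j + (-1) * ((s - 1 : ℕ) : ZMod M) := by
    rw [Nat.cast_sub hs0, hs]; push_cast; ring
  have eQ : i = j + 1 + 1 * ((M - s - 1 : ℕ) : ZMod M) := by
    rw [Nat.cast_sub (by omega), Nat.cast_sub (by omega), hs, hM0]; push_cast; ring
  constructor
  · intro h
    have := hasCyc_of_list (G := G) y (seg x (-1) s j ++ seg x 1 (M - s) (j + 1))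
      (by simp [seg_length]; omega) ?_ ?_
    · simp only [List.length_append, seg_length] at this
      convert this using 1; omega
    · rw [List.nodup_cons, List.nodup_append, List.mem_append]
      refine ⟨?_, n1, n2, ?_⟩
      · rintro (h | h) <;> exact hy1 y hy _ _ _ h
      · rintro a ha b hb rfl; exact hdis a ha hb
    · have c2 := seg_chain hG y [] (s := M - s) (by omega) eQ h1.symm (by simp) _ h
      obtain ⟨r, hr⟩ : ∃ r, M - s = r + 1 := ⟨M - s - 1, by omega⟩
      rw [hr, seg] at c2 ⊢
      simp only [List.append_assoc, List.cons_append] at c2 ⊢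
      exact seg_chain hG' _ _ hs0 eP h (List.IsChain.tail c2) y h2
  · intro y' hy' hyy h h'
    have := hasCyc_of_list (G := G) y (seg x (-1) s j ++ y' :: seg x 1 (M - s) (j + 1))
      (by simp; omega) ?_ ?_
    · simp only [List.length_append, List.length_cons, seg_length] at this
      convert this using 1; omega
    · rw [List.nodup_cons, List.nodup_append, List.mem_append, List.nodup_cons, List.mem_cons]
      refine ⟨?_, n1, ⟨hy1 y' hy' _ _ _, n2⟩, ?_⟩
      · rintro (h | h | h)
        · exact hy1 y hy _ _ _ h
        · exact hyy h
        · exact hy1 y hy _ _ _ h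
      · rintro a ha b hb rfl
        rw [List.mem_cons] at hb
        rcases hb with rfl | hb
        · exact hy1 _ hy' _ _ _ ha
        · exact hdis a ha hb
    · have c2 := seg_chain hG y [] (s := M - s) (by omega) eQ h1.symm (by simp) y' h'
      simp only [List.append_assoc, List.cons_append] at c2 ⊢
      exact seg_chain hG' _ _ hs0 eP h.symm c2 y h2

theorem count_ind {M : ℕ} [NeZero M] (S : Finset (ZMod M)) :
    2 * S.card ≤ M + (S.filter fun i => i + 1 ∈ S).card := by
  classical
  have h1 := Finset.card_union_add_card_inter S (S.image fun i => i + 1)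
  have h2 : (S.image fun i => i + 1).card = S.card :=
    Finset.card_image_of_injective _ (add_left_injective 1)
  have h3 : (S ∪ S.image fun i => i + 1).card ≤ M := by
    have := Finset.card_le_univ (S ∪ S.image fun i => i + 1)
    rwa [ZMod.card] at this
  have h4 : (S ∩ S.image fun i => i + 1) = (S.filter fun i => i + 1 ∈ S).image fun i => i + 1 := by
    ext j
    simp only [Finset.mem_inter, Finset.mem_image, Finset.mem_filter]
    constructor
    · rintro ⟨h, i, hi, rfl⟩; exact ⟨i, ⟨hi, h⟩, rfl⟩
    · rintro ⟨i, ⟨hi, h⟩, rfl⟩; exact ⟨h, i, hi, rfl⟩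
  rw [h4, Finset.card_image_of_injective _ (add_left_injective 1), h2] at h1
  omega

theorem card_compl_zmod {M : ℕ} [NeZero M] (A : Finset (ZMod M)) : Aᶜ.card + A.card = M := by
  have := Finset.card_compl_add_card A
  rwa [ZMod.card] at this

theorem pair_lower {M : ℕ} [NeZero M] (A A' : Finset (ZMod M))
    (hA : ∀ i, i ∈ A ∨ i + 1 ∈ A) (hA' : ∀ i, i ∈ A' ∨ i + 1 ∈ A')
    (hX : ∀ i j, i ≠ j → i ∉ A → j ∉ A → i + 1 ∉ A' → j + 1 ∉ A' → False)
    (hX' : ∀ i j, i ≠ j → i ∉ A' → j ∉ A' → i + 1 ∉ A → j + 1 ∉ A → False) :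
    M ≤ 2 * (A ∩ A').card + 2 := by
  classical
  have h := count_ind (A ∩ A')ᶜ
  have hc := card_compl_zmod (A ∩ A')
  have hsub : ((A ∩ A')ᶜ.filter fun i => i + 1 ∈ (A ∩ A')ᶜ) ⊆
      (Finset.univ.filter fun i => i ∉ A ∧ i + 1 ∉ A') ∪
      (Finset.univ.filter fun i => i ∉ A' ∧ i + 1 ∉ A) := by
    intro i
    simp only [Finset.mem_filter, Finset.mem_compl, Finset.mem_inter, Finset.mem_union,
      Finset.mem_univ, true_and]
    have := hA i
    have := hA' i
    tauto
  have h1 : (Finset.univ.filter fun i => i ∉ A ∧ i + 1 ∉ A').card ≤ 1 := by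
    rw [Finset.card_le_one]
    intro i hi j hj
    simp only [Finset.mem_filter, Finset.mem_univ, true_and] at hi hj
    by_contra hij
    exact hX i j hij hi.1 hj.1 hi.2 hj.2
  have h2 : (Finset.univ.filter fun i => i ∉ A' ∧ i + 1 ∉ A).card ≤ 1 := by
    rw [Finset.card_le_one]
    intro i hi j hj
    simp only [Finset.mem_filter, Finset.mem_univ, true_and] at hi hj
    by_contra hij
    exact hX' i j hij hi.1 hj.1 hi.2 hj.2
  have h3 := (Finset.card_le_card hsub).trans (Finset.card_union_le _ _)
  omega

theorem ind_lower {M : ℕ} [NeZero M] (T : Finset (ZMod M))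
    (hT : ∀ i, i ∈ T ∨ i + 1 ∈ T) : M ≤ 2 * T.card := by
  have h := count_ind Tᶜ
  have hc := card_compl_zmod T
  have : (Tᶜ.filter fun i => i + 1 ∈ Tᶜ) = ∅ := by
    rw [Finset.filter_eq_empty_iff]
    intro i hi
    rw [Finset.mem_compl] at hi ⊢
    have := hT i
    tauto
  rw [this, Finset.card_empty] at h
  omega

/-- Three sets with the same pairwise intersection. -/
theorem triple_lower {M : ℕ} [NeZero M] (A₁ A₂ A₃ T : Finset (ZMod M))
    (h1 : ∀ i, i ∈ A₁ ∨ i + 1 ∈ A₁) (h2 : ∀ i, i ∈ A₂ ∨ i + 1 ∈ A₂)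
    (h3 : ∀ i, i ∈ A₃ ∨ i + 1 ∈ A₃)
    (h12 : A₁ ∩ A₂ = T) (h23 : A₂ ∩ A₃ = T) (h31 : A₃ ∩ A₁ = T) : M ≤ 2 * T.card := by
  apply ind_lower
  intro i
  have e : ∀ j, (j ∈ A₁ ∧ j ∈ A₂ ↔ j ∈ T) ∧ (j ∈ A₂ ∧ j ∈ A₃ ↔ j ∈ T) ∧
      (j ∈ A₃ ∧ j ∈ A₁ ↔ j ∈ T) := by
    intro j
    refine ⟨?_, ?_, ?_⟩
    · rw [← h12, Finset.mem_inter]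
    · rw [← h23, Finset.mem_inter]
    · rw [← h31, Finset.mem_inter]
  have e1 := e i
  have e2 := e (i + 1)
  have := h1 i
  have := h2 i
  have := h3 i
  clear e h12 h23 h31 h1 h2 h3
  grind

/-- A special case of the marriage theorem. -/
theorem hall_special {ι α : Type*} [Fintype ι] [DecidableEq α] (t : ι → Finset α)
    (hc : ∀ i, Fintype.card ι ≤ (t i).card + 1) (a b : ι)
    (hab : Fintype.card ι ≤ (t a ∪ t b).card) :
    ∃ f : ι → α, Function.Injective f ∧ ∀ i, f i ∈ t i := by
  classical
  rw [← Finset.all_card_le_biUnion_card_iff_exists_injective]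
  intro s
  by_cases hs : s = Finset.univ
  · subst hs
    rw [Finset.card_univ]
    refine hab.trans (Finset.card_le_card ?_)
    exact Finset.union_subset (Finset.subset_biUnion_of_mem t (Finset.mem_univ a))
      (Finset.subset_biUnion_of_mem t (Finset.mem_univ b))
  · rcases s.eq_empty_or_nonempty with rfl | ⟨i, hi⟩
    · simp
    · have h1 : s.card < Fintype.card ι := by
        rw [← Finset.card_univ]
        exact Finset.card_lt_card (Finset.ssubset_univ_iff.2 hs)
      have h2 := Finset.card_le_card (Finset.subset_biUnion_of_mem t hi)
      have := hc i
      omega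

theorem alt_inj {V : Type*} {k : ℕ} {z t : ℕ → V} (r : ℕ) (hr : r ≤ 2 * k)
    (hz : ∀ i < k, ∀ j < k, z i = z j → i = j) (ht : ∀ i j, 2 * i + 1 < r → 2 * j + 1 < r →
      t i = t j → i = j)
    (hzt : ∀ i < k, ∀ j, 2 * j + 1 < r → z i ≠ t j) :
    ∀ i < r, ∀ j < r, (if i % 2 = 0 then z (i / 2) else t (i / 2)) =
      (if j % 2 = 0 then z (j / 2) else t (j / 2)) → i = j := by
  intro i hi j hj h
  split_ifs at h with h1 h2 h2
  · have := hz _ (by omega) _ (by omega) h; omega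
  · exact absurd h (hzt _ (by omega) _ (by omega))
  · exact absurd h.symm (hzt _ (by omega) _ (by omega))
  · have := ht _ _ (by omega) (by omega) h; omega

theorem alt_cycle {V : Type*} {G : SimpleGraph V} {k : ℕ} (hk : 2 ≤ k) (z t : ZMod k → V)
    (hz : Function.Injective z) (ht : Function.Injective t) (hzt : ∀ i j, z i ≠ t j)
    (h1 : ∀ i, G.Adj (z i) (t i)) (h2 : ∀ i, G.Adj (t i) (z (i + 1))) : HasCyc G (2 * k) := by
  refine hasCyc_of_nat (by omega) (fun n => if n % 2 = 0 then z ((n / 2 : ℕ) : ZMod k)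
    else t ((n / 2 : ℕ) : ZMod k)) ?_ ?_ ?_
  · refine alt_inj (k := k) (z := fun n : ℕ => z (n : ZMod k)) (t := fun n : ℕ => t (n : ZMod k))
      (2 * k) le_rfl ?_ ?_ ?_
    · intro i hi j hj h
      exact cast_inj_of_lt hi hj (hz h)
    · intro i j hi hj h
      exact cast_inj_of_lt (by omega) (by omega) (ht h)
    · intro i _ j _
      exact hzt _ _
  · intro i hi
    rcases Nat.even_or_odd' i with ⟨c, rfl | rfl⟩
    · have e1 : 2 * c % 2 = 0 := by omega
      have e2 : (2 * c + 1) % 2 ≠ 0 := by omega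
      have e3 : 2 * c / 2 = c := by omega
      have e4 : (2 * c + 1) / 2 = c := by omega
      simp only [e1, e2, e3, e4, if_true, if_false]
      exact h1 _
    · have e1 : (2 * c + 1 + 1) % 2 = 0 := by omega
      have e2 : (2 * c + 1) % 2 ≠ 0 := by omega
      have e3 : (2 * c + 1 + 1) / 2 = c + 1 := by omega
      have e4 : (2 * c + 1) / 2 = c := by omega
      simp only [e1, e2, e3, e4, if_true, if_false]
      have := h2 (c : ZMod k)
      push_cast
      exact this
  · have e2 : (2 * k - 1) % 2 ≠ 0 := by omega
    have e4 : (2 * k - 1) / 2 = k - 1 := by omega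
    simp only [e2, e4, if_false, Nat.zero_mod, Nat.zero_div, if_true]
    have := h2 ((k - 1 : ℕ) : ZMod k)
    have e : ((k - 1 : ℕ) : ZMod k) + 1 = ((0 : ℕ) : ZMod k) := by
      rw [Nat.cast_sub (by omega), ZMod.natCast_self]; simp
    rwa [e] at this

theorem alt_cycle' {V : Type*} {G : SimpleGraph V} {k : ℕ} (hk : 3 ≤ k) (z : ZMod k → V)
    (t : ℕ → V)
    (hz : Function.Injective z) (ht : ∀ i < k - 1, ∀ j < k - 1, t i = t j → i = j)
    (hzt : ∀ i, ∀ j < k - 1, z i ≠ t j)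
    (h1 : ∀ i < k - 1, G.Adj (z (i : ℕ)) (t i))
    (h2 : ∀ i < k - 1, G.Adj (t i) (z ((i : ℕ) + 1)))
    (hcl : G.Adj (z (-1)) (z 0)) : HasCyc G (2 * k - 1) := by
  refine hasCyc_of_nat (by omega) (fun n => if n % 2 = 0 then z ((n / 2 : ℕ) : ZMod k)
    else t (n / 2 : ℕ)) ?_ ?_ ?_
  · refine alt_inj (k := k) (z := fun n : ℕ => z (n : ZMod k)) (t := t)
      (2 * k - 1) (by omega) ?_ ?_ ?_
    · intro i hi j hj h
      exact cast_inj_of_lt hi hj (hz h)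
    · intro i j hi hj h
      exact ht _ (by omega) _ (by omega) h
    · intro i _ j _
      exact hzt _ _ (by omega)
  · intro i hi
    rcases Nat.even_or_odd' i with ⟨c, rfl | rfl⟩
    · have e1 : 2 * c % 2 = 0 := by omega
      have e2 : (2 * c + 1) % 2 ≠ 0 := by omega
      have e3 : 2 * c / 2 = c := by omega
      have e4 : (2 * c + 1) / 2 = c := by omega
      simp only [e1, e2, e3, e4, if_true, if_false]
      exact h1 _ (by omega)
    · have e1 : (2 * c + 1 + 1) % 2 = 0 := by omega
      have e2 : (2 * c + 1) % 2 ≠ 0 := by omega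
      have e3 : (2 * c + 1 + 1) / 2 = c + 1 := by omega
      have e4 : (2 * c + 1) / 2 = c := by omega
      simp only [e1, e2, e3, e4, if_true, if_false]
      have := h2 c (by omega)
      push_cast
      exact this
  · have e2 : (2 * k - 1 - 1) % 2 = 0 := by omega
    have e4 : (2 * k - 1 - 1) / 2 = k - 1 := by omega
    simp only [e2, e4, Nat.zero_mod, Nat.zero_div, if_true]
    have e : ((k - 1 : ℕ) : ZMod k) = -1 := by
      rw [Nat.cast_sub (by omega), ZMod.natCast_self]; simp
    rw [e, Nat.cast_zero]
    exact hcl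

theorem exists_listing {V : Type*} [DecidableEq V] {k : ℕ} (hk : 3 ≤ k) (Y : Finset V)
    (hY : k ≤ Y.card)
    {a b c : V} (ha : a ∈ Y) (hb : b ∈ Y) (hc : c ∈ Y) (hab : a ≠ b) (hbc : b ≠ c) (hac : a ≠ c) :
    ∃ z : ZMod k → V, Function.Injective z ∧ (∀ i, z i ∈ Y) ∧ z 0 = a ∧ z 1 = b ∧ z 2 = c := by
  have : NeZero k := ⟨by omega⟩
  have : Fact (1 < k) := ⟨by omega⟩
  set Y' := ((Y.erase a).erase b).erase c with hY'
  have hcard : Y'.card = Y.card - 3 := by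
    rw [hY', Finset.card_erase_of_mem, Finset.card_erase_of_mem, Finset.card_erase_of_mem ha]
    · omega
    · simp [hab.symm, hb]
    · simp [hbc.symm, hac.symm, hc]
  have hlen : (a :: b :: c :: Y'.toList.take (k - 3)).length = k := by
    simp [hcard]; omega
  have hsub : ∀ v ∈ Y'.toList.take (k - 3), v ∈ Y' := fun v hv =>
    Finset.mem_toList.1 (List.mem_of_mem_take hv)
  have hnd : (a :: b :: c :: Y'.toList.take (k - 3)).Nodup := by
    have hn : (Y'.toList.take (k - 3)).Nodup := (Finset.nodup_toList Y').sublist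
      (List.take_sublist _ _)
    simp only [List.nodup_cons, List.mem_cons, not_or]
    refine ⟨⟨hab, hac, fun h => ?_⟩, ⟨hbc, fun h => ?_⟩, fun h => ?_, hn⟩ <;>
      · have := hsub _ h
        simp [hY'] at this
  have hmem : ∀ v ∈ (a :: b :: c :: Y'.toList.take (k - 3)), v ∈ Y := by
    intro v hv
    simp only [List.mem_cons] at hv
    rcases hv with rfl | rfl | rfl | hv
    · exact ha
    · exact hb
    · exact hc
    · have := hsub _ hv
      simp [hY'] at this
      exact this.2.2.2
  have h2 : ((2 : ℕ) : ZMod k).val = 2 := by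
    rw [ZMod.val_natCast, Nat.mod_eq_of_lt (by omega)]
  refine ⟨fun i => (a :: b :: c :: Y'.toList.take (k - 3))[i.val]'(by
    rw [hlen]; exact ZMod.val_lt i), ?_, ?_, ?_, ?_, ?_⟩
  · intro i j h
    exact ZMod.val_injective k ((List.Nodup.getElem_inj_iff hnd).1 h)
  · intro i
    exact hmem _ (List.getElem_mem _)
  · simp
  · simp only [ZMod.val_one k]; rfl
  · have h2' : (2 : ZMod k).val = 2 := by exact_mod_cast h2
    simp only [h2']; rfl

theorem union_eq_of_card {α : Type*} [DecidableEq α] {S T : Finset α} {n : ℕ} (hS : n ≤ S.card)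
    (hT : n ≤ T.card) (h : (S ∪ T).card ≤ n) : S = T ∧ S.card = n := by
  have h1 : S = S ∪ T := Finset.eq_of_subset_of_card_le Finset.subset_union_left (by omega)
  have h2 : T = S ∪ T := Finset.eq_of_subset_of_card_le Finset.subset_union_right (by omega)
  refine ⟨h1.trans h2.symm, ?_⟩
  rw [← h1] at h
  omega

theorem core1 {V : Type*} [DecidableEq V] {R : SimpleGraph V} {k M : ℕ} (hk : 3 ≤ k)
    {x : ZMod M → V} (hx : Function.Injective x) (A : V → Finset (ZMod M))
    (hA : ∀ y i, i ∈ A y → R.Adj y (x i)) (Y : Finset V) (hY : k ≤ Y.card)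
    (hYx : ∀ y ∈ Y, ∀ i, x i ≠ y)
    (hc : ∀ y ∈ Y, ∀ y' ∈ Y, y ≠ y' → k ≤ (A y ∩ A y').card + 1)
    (hR : ¬ HasCyc R (2 * k))
    {a b c : V} (ha : a ∈ Y) (hb : b ∈ Y) (hc' : c ∈ Y) (hab : a ≠ b) (hbc : b ≠ c) (hac : a ≠ c) :
    A a ∩ A b = A b ∩ A c ∧ (A a ∩ A b).card = k - 1 := by
  have : NeZero k := ⟨by omega⟩
  have : Fact (1 < k) := ⟨by omega⟩
  obtain ⟨z, hz, hzY, z0, z1, z2⟩ := exists_listing hk Y hY ha hb hc' hab hbc hac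
  have key : ∀ i, k ≤ (A (z i) ∩ A (z (i + 1))).card + 1 := by
    intro i
    refine hc _ (hzY _) _ (hzY _) ?_
    intro h
    have := hz h
    simp at this
  have k1 := hc a ha b hb hab
  have k2 := hc b hb c hc' hbc
  apply union_eq_of_card (by omega) (by omega)
  by_contra hcon
  obtain ⟨f, hf, hft⟩ := hall_special (fun i : ZMod k => A (z i) ∩ A (z (i + 1)))
    (by intro i; rw [ZMod.card]; exact key i) 0 1 (by
      have : (1 : ZMod k) + 1 = 2 := by norm_num
      rw [ZMod.card, zero_add, z0, z1, this, z2]; omega)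
  apply hR
  refine alt_cycle (by omega) z (fun i => x (f i)) hz (hx.comp hf) ?_ ?_ ?_
  · intro i j h
    exact hYx _ (hzY i) _ h.symm
  · intro i
    exact hA _ _ (Finset.mem_inter.1 (hft i)).1
  · intro i
    exact (hA _ _ (Finset.mem_inter.1 (hft i)).2).symm

theorem core2 {V : Type*} [DecidableEq V] {R : SimpleGraph V} {k M : ℕ} (hk : 3 ≤ k)
    {x : ZMod M → V} (hx : Function.Injective x) (A : V → Finset (ZMod M))
    (hA : ∀ y i, i ∈ A y → R.Adj y (x i)) (Y : Finset V)
    (hYx : ∀ y ∈ Y, ∀ i, x i ≠ y)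
    (hc : ∀ y ∈ Y, ∀ y' ∈ Y, y ≠ y' → k ≤ (A y ∩ A y').card + 2)
    (hR : ¬ HasCyc R (2 * k - 1))
    (z : ZMod k → V) (hz : Function.Injective z) (hzY : ∀ i, z i ∈ Y)
    (hcl : R.Adj (z (-1)) (z 0)) :
    A (z 0) ∩ A (z 1) = A (z 1) ∩ A (z 2) ∧ (A (z 0) ∩ A (z 1)).card = k - 2 := by
  have : NeZero k := ⟨by omega⟩
  have : Fact (1 < k) := ⟨by omega⟩
  have e2 : (1 : ZMod k) + 1 = 2 := by norm_num
  have key : ∀ i, k ≤ (A (z i) ∩ A (z (i + 1))).card + 2 := by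
    intro i
    refine hc _ (hzY _) _ (hzY _) ?_
    intro h
    have := hz h
    simp at this
  have k1 := key 0
  have k2 := key 1
  rw [zero_add] at k1
  rw [e2] at k2
  apply union_eq_of_card (by omega) (by omega)
  by_contra hcon
  obtain ⟨f, hf, hft⟩ := hall_special
    (fun i : Fin (k - 1) => A (z (i.val : ℕ)) ∩ A (z ((i.val : ℕ) + 1)))
    (by intro i; rw [Fintype.card_fin]; have := key (i.val : ℕ); omega)
    ⟨0, by omega⟩ ⟨1, by omega⟩ (by
      simp only [Nat.cast_zero, Nat.cast_one, zero_add, e2, Fintype.card_fin]; omega)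
  apply hR
  have fe : ∀ i (h : i < k - 1), (if h : i < k - 1 then x (f ⟨i, h⟩) else z 0) = x (f ⟨i, h⟩) :=
    fun i h => dif_pos h
  refine alt_cycle' hk z (fun i => if h : i < k - 1 then x (f ⟨i, h⟩) else z 0) hz ?_ ?_ ?_ ?_ hcl
  · intro i hi j hj h
    simp only [fe i hi, fe j hj] at h
    have := hf (hx h)
    simpa using this
  · intro i j hj
    simp only [fe j hj]
    intro h
    exact hYx _ (hzY i) _ h.symm
  · intro i hi
    simp only [fe i hi]
    exact hA _ _ (Finset.mem_inter.1 (hft ⟨i, hi⟩)).1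
  · intro i hi
    simp only [fe i hi]
    exact (hA _ _ (Finset.mem_inter.1 (hft ⟨i, hi⟩)).2).symm

theorem main_lemma {V : Type*} [DecidableEq V] {R : SimpleGraph V} {k M : ℕ} (hk : 3 ≤ k)
    (hM : 2 * k - 1 ≤ M)
    {x : ZMod M → V} (hx : Function.Injective x) (A : V → Finset (ZMod M))
    (hA : ∀ y i, i ∈ A y → R.Adj y (x i)) (Y : Finset V) (hY : k ≤ Y.card)
    (hYx : ∀ y ∈ Y, ∀ i, x i ≠ y)
    (hI : ∀ y ∈ Y, ∀ i, i ∈ A y ∨ i + 1 ∈ A y)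
    (hX : ∀ y ∈ Y, ∀ y' ∈ Y, y ≠ y' → ∀ i j, i ≠ j → i ∉ A y → j ∉ A y → i + 1 ∉ A y' →
      j + 1 ∉ A y' → False) : HasCyc R (2 * k) := by
  by_contra hR
  have : NeZero M := ⟨by omega⟩
  have hc : ∀ y ∈ Y, ∀ y' ∈ Y, y ≠ y' → k ≤ (A y ∩ A y').card + 1 := by
    intro y hy y' hy' hne
    have := pair_lower (A y) (A y') (hI y hy) (hI y' hy') (hX y hy y' hy' hne)
      (hX y' hy' y hy hne.symm)
    omega
  obtain ⟨a, b, c, ha, hb, hc', hab, hac, hbc⟩ := Finset.two_lt_card_iff.1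
    (show 2 < Y.card by omega)
  obtain ⟨e1, f1⟩ := core1 hk hx A hA Y hY hYx hc hR ha hb hc' hab hbc hac
  obtain ⟨e2, f2⟩ := core1 hk hx A hA Y hY hYx hc hR hb hc' ha hbc hac.symm hab.symm
  have := triple_lower (A a) (A b) (A c) (A a ∩ A b) (hI a ha) (hI b hb) (hI c hc') rfl
    e1.symm (e1.trans e2).symm
  omega

/-- Odd cycles all of whose chords of distance two have the other colour. -/
theorem shift_lemma {V : Type*} {R B : SimpleGraph V}
    (hc : ∀ u v, u ≠ v → R.Adj u v ∨ B.Adj u v) {k l M : ℕ} (hk : 2 ≤ k) (hkl : k ≤ l)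
    (hM : M = 2 * l + 1) {x : ZMod M → V} (hx : Function.Injective x)
    (hB : ∀ i, B.Adj (x i) (x (i + 1))) (hR : ∀ i, R.Adj (x i) (x (i + 2)))
    {y : V} (hy : ∀ i, x i ≠ y) : HasCyc R (2 * k) ∨ HasCyc B (2 * l) := by
  classical
  by_contra hcon
  rw [not_or] at hcon
  have : NeZero M := ⟨by omega⟩
  have half : ∀ (S : Finset (ZMod M)) (d : ZMod M), (∀ i ∈ S, i + d ∉ S) → S.card ≤ l := by
    intro S d hS
    have h1 : Disjoint S (S.image fun i => i + d) := by
      rw [Finset.disjoint_left]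
      intro i hi hi'
      rw [Finset.mem_image] at hi'
      obtain ⟨j, hj, rfl⟩ := hi'
      exact hS j hj hi
    have h2 := Finset.card_le_univ (S ∪ S.image fun i => i + d)
    rw [Finset.card_union_of_disjoint h1,
      Finset.card_image_of_injective _ (add_left_injective d), ZMod.card] at h2
    omega
  set A : Finset (ZMod M) := Finset.univ.filter fun i => R.Adj y (x i) with hA
  have h1 := half A (2 * ((2 * k - 1 - 1 : ℕ) : ZMod M)) (by
    intro i hi hi'
    simp only [hA, Finset.mem_filter, Finset.mem_univ, true_and] at hi hi'
    apply hcon.1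
    have := cyc_one hx (d := 2) (s := 2 * k - 1) (a := i) (by omega) ?_ hR rfl hy hi hi'
    · convert this using 1; omega
    · intro t t' ht ht' e
      have e' : ((2 * t : ℕ) : ZMod M) = ((2 * t' : ℕ) : ZMod M) := by exact_mod_cast e
      rw [ZMod.natCast_eq_natCast_iff] at e'
      have hcop : Nat.gcd M 2 = 1 := by
        have : Nat.Coprime 2 M := by rw [Nat.coprime_two_left]; exact ⟨l, hM⟩
        exact this.symm
      have := Nat.ModEq.cancel_left_of_coprime hcop e'
      exact Nat.ModEq.eq_of_lt_of_lt this (by omega) (by omega))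
  have h2 := half Aᶜ (1 * ((2 * l - 1 - 1 : ℕ) : ZMod M)) (by
    intro i hi hi'
    simp only [hA, Finset.mem_compl, Finset.mem_filter, Finset.mem_univ, true_and] at hi hi'
    have g := (hc y (x i) (hy i).symm).resolve_left hi
    have g' := (hc y (x _) (hy _).symm).resolve_left hi'
    apply hcon.2
    have := cyc_one hx (d := 1) (s := 2 * l - 1) (a := i) (by omega) ?_ hB rfl hy g g'
    · convert this using 1; omega
    · intro t t' ht ht' e
      rw [one_mul, one_mul] at e
      exact cast_inj_of_lt (by omega) (by omega) e)
  have := card_compl_zmod A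
  omega

theorem exists_outside {V : Type*} [Fintype V] [DecidableEq V] {M : ℕ} [NeZero M] (x : ZMod M → V)
    (hx : Function.Injective x) : ∃ Y : Finset V, Y.card + M = Fintype.card V ∧
      ∀ y ∈ Y, ∀ i, x i ≠ y := by
  refine ⟨(Finset.univ.image x)ᶜ, ?_, ?_⟩
  · have := Finset.card_compl_add_card (Finset.univ.image x)
    rwa [Finset.card_image_of_injective _ hx, Finset.card_univ, ZMod.card] at this
  · intro y hy i h
    rw [Finset.mem_compl, Finset.mem_image] at hy
    exact hy ⟨i, Finset.mem_univ _, h⟩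

theorem no_odd {V : Type*} [Fintype V] {R B : SimpleGraph V}
    (hc : ∀ u v, u ≠ v → R.Adj u v ∨ B.Adj u v) {k l : ℕ} (hk : 2 ≤ k) (hkl : k ≤ l)
    (hV : 2 * l + 2 ≤ Fintype.card V) (h : HasCyc B (2 * l + 1)) :
    HasCyc R (2 * k) ∨ HasCyc B (2 * l) := by
  classical
  obtain ⟨x, hx, hB⟩ := h
  by_cases hR : ∀ i, R.Adj (x i) (x (i + 2))
  · obtain ⟨Y, hY, hYx⟩ := exists_outside x hx
    obtain ⟨y, hy⟩ := Finset.card_pos.1 (show 0 < Y.card by omega)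
    exact shift_lemma hc hk hkl rfl hx hB hR (hYx y hy)
  · right
    push Not at hR
    obtain ⟨i, hi⟩ := hR
    refine cyc_shorten (M := 2 * l + 1) (by omega) hx hB (i := i)
      ((hc _ _ ?_).resolve_left hi)
    intro h
    have h := hx h
    have h2 : ((0 : ℕ) : ZMod (2 * l + 1)) = ((2 : ℕ) : ZMod (2 * l + 1)) := by
      push_cast
      have : i + 0 = i + 2 := by rw [add_zero]; exact h
      exact add_left_cancel this
    have := cast_inj_of_lt (by omega) (by omega) h2
    omega

theorem cyc_four {V : Type*} {G : SimpleGraph V} {p q r s : V} (hpr : p ≠ r) (hqs : q ≠ s)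
    (h1 : G.Adj p q) (h2 : G.Adj q r) (h3 : G.Adj r s) (h4 : G.Adj s p) : HasCyc G 4 := by
  refine hasCyc_of_list (G := G) p [q, r, s] (by simp) ?_ ?_
  · simp [hpr, hqs, h1.ne, h2.ne, h3.ne, h4.ne.symm]
  · simp [h1, h2, h3, h4]

theorem base_aux {V : Type*} {R B : SimpleGraph V}
    (hc : ∀ u v, u ≠ v → R.Adj u v ∨ B.Adj u v) {v a b c d e : V}
    (hn : [v, a, b, c, d, e].Nodup)
    (va : R.Adj v a) (vb : R.Adj v b) (vc : R.Adj v c) : HasCyc R 4 ∨ HasCyc B 4 := by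
  by_contra hcon
  rw [not_or] at hcon
  have nR : ∀ p q r s, p ≠ r → q ≠ s → R.Adj p q → R.Adj q r → R.Adj r s → ¬ R.Adj s p :=
    fun p q r s h1 h2 a1 a2 a3 a4 => hcon.1 (cyc_four h1 h2 a1 a2 a3 a4)
  have nB : ∀ p q r s, p ≠ r → q ≠ s → B.Adj p q → B.Adj q r → B.Adj r s → ¬ B.Adj s p :=
    fun p q r s h1 h2 a1 a2 a3 a4 => hcon.2 (cyc_four h1 h2 a1 a2 a3 a4)
  simp only [List.nodup_cons, List.mem_cons, List.not_mem_nil, or_false, not_or] at hn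
  obtain ⟨⟨n1, n2, n3, n4, n5⟩, ⟨n6, n7, n8, n9⟩, ⟨n10, n11, n12⟩, ⟨n13, n14⟩, n15, -⟩ := hn
  -- no vertex other than `v` sends two red edges to `a, b, c`
  have two : ∀ p q u, p ≠ q → v ≠ u → R.Adj v p → R.Adj v q → R.Adj u p → R.Adj u q → False :=
    fun p q u h1 h2 a1 a2 a3 a4 => nR v p u q h2 h1 a1 a3.symm a4 a2.symm
  have blue : ∀ u w, u ≠ w → ¬ R.Adj u w → B.Adj u w := fun u w h h' => (hc u w h).resolve_left h'
  have gen : ∀ a b c : V, a ≠ b → a ≠ c → b ≠ c → a ≠ d → a ≠ e → b ≠ d → b ≠ e → c ≠ d → c ≠ e →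
      v ≠ a → v ≠ b → v ≠ c →
      R.Adj v a → R.Adj v b → R.Adj v c → B.Adj d a → B.Adj d b → B.Adj e b → B.Adj e c →
      False := by
    intro a b c hab hac hbc had hae hbd hbe hcd hce hva hvb hvc va vb vc da db eb ec
    have ea : R.Adj e a := by
      by_contra h
      exact nB d a e b n15 hab da (blue e a hae.symm h).symm eb db.symm
    have dc : R.Adj d c := by
      by_contra h
      exact nB d b e c n15 hbc db eb.symm ec (blue d c hcd.symm h).symm
    by_cases ab : R.Adj a b
    · have bc := blue b c hbc fun h => two a c b hac hvb va vc ab.symm h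
      have ac := blue a c hac fun h => two b c a hbc hva vb vc ab h
      exact nB a d b c hab hcd.symm da.symm db bc ac.symm
    · have ab := blue a b hab ab
      by_cases bc : R.Adj b c
      · have ac := blue a c hac fun h => two a b c hab hvc va vb h.symm bc.symm
        exact nB a c e b hae hbc.symm ac ec.symm eb ab.symm
      · have bc := blue b c hbc bc
        by_cases ac : R.Adj a c
        · by_cases de : R.Adj d e
          · exact nR c a e d hce had ac.symm ea.symm de.symm dc
          · have de := blue d e n15 de
            exact nB d a b e hbd.symm hae da ab eb.symm de.symm
        · have ac := blue a c hac ac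
          exact nB a d b c hab hcd.symm da.symm db bc ac.symm
  have dpair : ∀ u, v ≠ u → u ≠ a → u ≠ b → u ≠ c →
      (B.Adj u a ∧ B.Adj u b) ∨ (B.Adj u b ∧ B.Adj u c) ∨ (B.Adj u a ∧ B.Adj u c) := by
    intro u hu ua ub uc
    have := two a b u n6 hu va vb
    have := two b c u n10 hu vb vc
    have := two a c u n7 hu va vc
    have := hc u a ua
    have := hc u b ub
    have := hc u c uc
    tauto
  rcases dpair d n4 (Ne.symm n8) (Ne.symm n11) (Ne.symm n13) with ⟨d1, d2⟩ | ⟨d1, d2⟩ | ⟨d1, d2⟩ <;>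
  rcases dpair e n5 (Ne.symm n9) (Ne.symm n12) (Ne.symm n14) with ⟨e1, e2⟩ | ⟨e1, e2⟩ | ⟨e1, e2⟩
  · exact nB d a e b n15 n6 d1 e1.symm e2 d2.symm
  · exact gen a b c n6 n7 n10 n8 n9 n11 n12 n13 n14 n1 n2 n3 va vb vc d1 d2 e1 e2
  · exact gen b a c (Ne.symm n6) n10 n7 n11 n12 n8 n9 n13 n14 n2 n1 n3 vb va vc d2 d1 e1 e2
  · exact gen c b a (Ne.symm n10) (Ne.symm n7) (Ne.symm n6) n13 n14 n11 n12 n8 n9 n3 n2 n1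
      vc vb va d2 d1 e2 e1
  · exact nB d b e c n15 n10 d1 e1.symm e2 d2.symm
  · exact gen b c a n10 (Ne.symm n6) (Ne.symm n7) n11 n12 n13 n14 n8 n9 n2 n3 n1
      vb vc va d1 d2 e2 e1
  · exact gen c a b (Ne.symm n7) (Ne.symm n10) n6 n13 n14 n8 n9 n11 n12 n3 n1 n2
      vc va vb d2 d1 e1 e2
  · exact gen a c b n7 n6 (Ne.symm n10) n8 n9 n13 n14 n11 n12 n1 n3 n2 va vc vb d1 d2 e2 e1
  · exact nB d a e c n15 n7 d1 e1.symm e2 d2.symm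

theorem base_four {V : Type*} [Fintype V] {R B : SimpleGraph V}
    (hc : ∀ u v, u ≠ v → R.Adj u v ∨ B.Adj u v) (hV : 6 ≤ Fintype.card V) :
    HasCyc R 4 ∨ HasCyc B 4 := by
  have key : ∀ {R B : SimpleGraph V}, (∀ u v, u ≠ v → R.Adj u v ∨ B.Adj u v) →
      ∀ v a b c d e, [v, a, b, c, d, e].Nodup → R.Adj v a → R.Adj v b → R.Adj v c →
      HasCyc R 4 ∨ HasCyc B 4 := fun hc v a b c d e h h1 h2 h3 => base_aux hc h h1 h2 h3
  have hc' : ∀ u v, u ≠ v → B.Adj u v ∨ R.Adj u v := fun u v h => (hc u v h).symm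
  obtain ⟨g⟩ : Nonempty (Fin 6 ↪ V) := by
    apply Function.Embedding.nonempty_of_card_le
    simpa using hV
  have hne : ∀ i j, i ≠ j → g i ≠ g j := fun i j h h' => h (g.injective h')
  have k1 : ∀ i j m p q : Fin 6, [0, i, j, m, p, q].Nodup → R.Adj (g 0) (g i) → R.Adj (g 0) (g j) →
      R.Adj (g 0) (g m) → HasCyc R 4 ∨ HasCyc B 4 := by
    intro i j m p q h
    refine key hc _ _ _ _ (g p) (g q) ?_
    exact h.map g.injective
  have k2 : ∀ i j m p q : Fin 6, [0, i, j, m, p, q].Nodup → B.Adj (g 0) (g i) → B.Adj (g 0) (g j) →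
      B.Adj (g 0) (g m) → HasCyc R 4 ∨ HasCyc B 4 := by
    intro i j m p q h h1 h2 h3
    refine (key hc' _ _ _ _ (g p) (g q) ?_ h1 h2 h3).symm
    exact h.map g.injective
  rcases hc _ _ (hne 0 1 (by decide)) with h1 | h1 <;>
  rcases hc _ _ (hne 0 2 (by decide)) with h2 | h2 <;>
  rcases hc _ _ (hne 0 3 (by decide)) with h3 | h3 <;>
  rcases hc _ _ (hne 0 4 (by decide)) with h4 | h4 <;>
  rcases hc _ _ (hne 0 5 (by decide)) with h5 | h5 <;>
  first
  | exact k1 1 2 3 4 5 (by decide) h1 h2 h3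
  | exact k2 1 2 3 4 5 (by decide) h1 h2 h3
  | exact k1 1 2 4 3 5 (by decide) h1 h2 h4
  | exact k2 1 2 4 3 5 (by decide) h1 h2 h4
  | exact k1 1 2 5 3 4 (by decide) h1 h2 h5
  | exact k2 1 2 5 3 4 (by decide) h1 h2 h5
  | exact k1 1 3 4 2 5 (by decide) h1 h3 h4
  | exact k2 1 3 4 2 5 (by decide) h1 h3 h4
  | exact k1 1 3 5 2 4 (by decide) h1 h3 h5
  | exact k2 1 3 5 2 4 (by decide) h1 h3 h5
  | exact k1 1 4 5 2 3 (by decide) h1 h4 h5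
  | exact k2 1 4 5 2 3 (by decide) h1 h4 h5
  | exact k1 2 3 4 1 5 (by decide) h2 h3 h4
  | exact k2 2 3 4 1 5 (by decide) h2 h3 h4
  | exact k1 2 3 5 1 4 (by decide) h2 h3 h5
  | exact k2 2 3 5 1 4 (by decide) h2 h3 h5
  | exact k1 2 4 5 1 3 (by decide) h2 h4 h5
  | exact k2 2 4 5 1 3 (by decide) h2 h4 h5
  | exact k1 3 4 5 1 2 (by decide) h3 h4 h5
  | exact k2 3 4 5 1 2 (by decide) h3 h4 h5

theorem ins1 {V : Type*} {M : ℕ} (hM : 2 ≤ M) {B : SimpleGraph V} {x : ZMod M → V}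
    (hx : Function.Injective x) (hB : ∀ i, B.Adj (x i) (x (i + 1))) {y : V} (hy : ∀ i, x i ≠ y)
    {i : ZMod M} (h1 : B.Adj y (x i)) (h2 : B.Adj y (x (i + 1))) : HasCyc B (M + 1) := by
  refine cyc_one hx (d := 1) (s := M) (a := i + 1) (b := i) (by omega) ?_ hB ?_ hy h2 h1
  · intro t t' ht ht' e
    rw [one_mul, one_mul] at e
    exact cast_inj_of_lt ht ht' e
  · rw [Nat.cast_sub (by omega), ZMod.natCast_self]; push_cast; ring

theorem ins2 {V : Type*} {M : ℕ} (hM : 2 ≤ M) {B : SimpleGraph V} {x : ZMod M → V}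
    (hx : Function.Injective x) (hB : ∀ i, B.Adj (x i) (x (i + 1))) {y y' : V}
    (hy : ∀ i, x i ≠ y) (hy' : ∀ i, x i ≠ y') (hyy : B.Adj y y')
    {i : ZMod M} (h1 : B.Adj y (x i)) (h2 : B.Adj y' (x (i + 1))) : HasCyc B (M + 2) := by
  refine cyc_two hx (d := 1) (s := M) (a := i + 1) (b := i) (by omega) ?_ hB ?_ hy hy' hyy h2 h1
  · intro t t' ht ht' e
    rw [one_mul, one_mul] at e
    exact cast_inj_of_lt ht ht' e
  · rw [Nat.cast_sub (by omega), ZMod.natCast_self]; push_cast; ring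

theorem ins3 {V : Type*} {M : ℕ} (hM : 2 ≤ M) {B : SimpleGraph V} {x : ZMod M → V}
    (hx : Function.Injective x) (hB : ∀ i, B.Adj (x i) (x (i + 1))) {y y' : V}
    (hy : ∀ i, x i ≠ y) (hy' : ∀ i, x i ≠ y') (hyy : B.Adj y y')
    {i : ZMod M} (h1 : B.Adj y (x i)) (h2 : B.Adj y' (x (i + 2))) : HasCyc B (M + 1) := by
  have := cyc_two hx (d := 1) (s := M - 1) (a := i + 2) (b := i) (by omega) ?_ hB ?_ hy hy' hyy h2 h1
  · convert this using 1; omega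
  · intro t t' ht ht' e
    rw [one_mul, one_mul] at e
    exact cast_inj_of_lt (by omega) (by omega) e
  · have : M - 1 - 1 = M - 2 := by omega
    rw [this, Nat.cast_sub (by omega), ZMod.natCast_self]; push_cast; ring

theorem two_common {V : Type*} {R : SimpleGraph V} {M : ℕ} {x : ZMod M → V}
    (hx : Function.Injective x) {y y' : V} (hne : y ≠ y') (T : Finset (ZMod M))
    (hT : ∀ i ∈ T, R.Adj y (x i) ∧ R.Adj y' (x i)) (hcard : 2 ≤ T.card) : HasCyc R 4 := by
  obtain ⟨i, hi, j, hj, hij⟩ := Finset.one_lt_card.1 (show 1 < T.card by omega)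
  exact cyc_four hne (fun h => hij (hx h)) (hT i hi).1 (hT i hi).2.symm (hT j hj).2 (hT j hj).1.symm

theorem caseA_two {V : Type*} [Fintype V] {R B : SimpleGraph V}
    (hc : ∀ u v, u ≠ v → R.Adj u v ∨ B.Adj u v) {l : ℕ} (hl : 3 ≤ l)
    (hV : 2 * l + 1 ≤ Fintype.card V) (h : HasCyc B (2 * l - 1)) :
    HasCyc R 4 ∨ HasCyc B (2 * l) := by
  classical
  by_contra hcon
  rw [not_or] at hcon
  obtain ⟨hR, hBl⟩ := hcon
  have e1 : 2 * l = 2 * l - 1 + 1 := by omega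
  rw [e1] at hBl
  obtain ⟨M, hM⟩ : ∃ M, M = 2 * l - 1 := ⟨_, rfl⟩
  rw [← hM] at hBl h
  have : NeZero M := ⟨by omega⟩
  obtain ⟨x, hx, hB⟩ := h
  obtain ⟨Y, hY, hYx⟩ := exists_outside x hx
  obtain ⟨y, hy, y', hy', hne⟩ := Finset.one_lt_card.1 (show 1 < Y.card by omega)
  have bl : ∀ y ∈ Y, ∀ i, ¬ R.Adj y (x i) → B.Adj y (x i) :=
    fun y hy i => (hc y (x i) (hYx y hy i).symm).resolve_left
  have hI : ∀ y ∈ Y, ∀ i, ¬ R.Adj y (x i) → R.Adj y (x (i + 1)) := by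
    intro y hy i h1
    by_contra h2
    exact hBl (ins1 (by omega) hx hB (hYx y hy) (bl y hy _ h1) (bl y hy _ h2))
  have hI' : ∀ y ∈ Y, ∀ i, ¬ R.Adj y (x i) → R.Adj y (x (i - 1)) := by
    intro y hy i h1
    by_contra h2
    exact h1 (by have := hI y hy _ h2; rwa [sub_add_cancel] at this)
  have hS : ∀ y ∈ Y, ∀ i j, i ≠ j → ¬ R.Adj y (x i) → ¬ R.Adj y (x j) →
      R.Adj (x (i + 1)) (x (j + 1)) := by
    intro y hy i j hij h1 h2
    by_contra h3
    refine hBl ((cyc_cross hx hB hij (hYx y hy) (bl y hy _ h1) (bl y hy _ h2)).1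
      ((hc _ _ ?_).resolve_left h3))
    intro h
    exact hij (add_right_cancel (hx h))
  have hB' : ∀ i, B.Adj ((fun i => x (-i)) i) ((fun i => x (-i)) (i + 1)) := by
    intro i
    have := (hB (-(i + 1))).symm
    have e : -(i + 1) + 1 = -i := by ring
    rwa [e] at this
  have hx' : Function.Injective (fun i => x (-i)) := hx.comp neg_injective
  have hS' : ∀ y ∈ Y, ∀ i j, i ≠ j → ¬ R.Adj y (x i) → ¬ R.Adj y (x j) →
      R.Adj (x (i - 1)) (x (j - 1)) := by
    intro y hy i j hij h1 h2
    by_contra h3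
    refine hBl ((cyc_cross (i := -i) (j := -j) hx' hB' (fun h => hij (neg_injective h))
      (y := y) (fun i => hYx y hy _) (by simpa using bl y hy _ h1)
      (by simpa using bl y hy _ h2)).1 ?_)
    have e : ∀ i : ZMod M, -(-i + 1) = i - 1 := by intro i; ring
    simp only [e]
    refine (hc _ _ ?_).resolve_left h3
    intro h
    exact hij (sub_left_injective (hx h))
  set A : V → Finset (ZMod M) := fun y => Finset.univ.filter fun i => R.Adj y (x i) with hA
  have memA : ∀ y i, i ∈ A y ↔ R.Adj y (x i) := by intro y i; simp [hA]
  have b2 : ∀ y ∈ Y, (A y)ᶜ.card ≤ 2 := by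
    intro y hy
    by_contra hcon
    obtain ⟨a, b, c, ha, hb, hc', hab, hac, hbc⟩ := Finset.two_lt_card_iff.1 (not_le.1 hcon)
    rw [Finset.mem_compl, memA] at ha hb hc'
    apply hR
    refine cyc_four (p := y) (q := x (a + 1)) (r := x (b + 1)) (s := x (c + 1))
      (hYx y hy _).symm (fun h => hac (add_right_cancel (hx h))) (hI y hy _ ha)
      (hS y hy _ _ hab ha hb) (hS y hy _ _ hbc hb hc') (hI y hy _ hc').symm
  have hun : M ≤ (A y ∩ A y').card + ((A y)ᶜ.card + (A y')ᶜ.card) := by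
    have h1 := card_compl_zmod (A y ∩ A y')
    have h2 : (A y ∩ A y')ᶜ.card ≤ (A y)ᶜ.card + (A y')ᶜ.card := by
      rw [Finset.compl_inter]; exact Finset.card_union_le _ _
    omega
  have fin : (A y ∩ A y').card < 2 := by
    by_contra hcon
    refine hR (two_common hx hne (A y ∩ A y') ?_ (not_lt.1 hcon))
    intro i hi
    rw [Finset.mem_inter, memA, memA] at hi
    exact hi
  have := b2 y hy
  have := b2 y' hy'
  have hl3 : M = 5 := by omega
  subst hl3
  have dist2 : ∀ y ∈ Y, ∀ i, ¬ R.Adj y (x i) → R.Adj y (x (i + 2)) := by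
    intro y hy i h1
    by_contra h2
    have five : ∀ i : ZMod 5, i ≠ i + 2 ∧ i - 1 ≠ i + 2 + 1 := by decide
    have hne2 : i ≠ i + 2 := (five i).1
    have a1 := hS y hy _ _ hne2 h1 h2
    have a2 := hS' y hy _ _ hne2 h1 h2
    have a3 := hI y hy _ h2
    have a4 := hI' y hy _ h1
    have e : i + 2 - 1 = i + 1 := by ring
    rw [e] at a2
    refine hR (cyc_four (hYx y hy _).symm (fun h => ?_) a4 a2 a1 a3.symm)
    exact (five i).2 (hx h)
  have b1 : ∀ y ∈ Y, (A y)ᶜ.card ≤ 1 := by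
    intro y hy
    rw [Finset.card_le_one]
    intro i hi j hj
    rw [Finset.mem_compl, memA] at hi hj
    by_contra hij
    have : j = i + 1 ∨ j = i + 2 ∨ i = j + 1 ∨ i = j + 2 := by
      revert hij; clear hi hj; revert i j; decide
    rcases this with h | h | h | h
    · exact hj (h ▸ hI y hy _ hi)
    · exact hj (h ▸ dist2 y hy _ hi)
    · exact hi (h ▸ hI y hy _ hj)
    · exact hi (h ▸ dist2 y hy _ hj)
  have := b1 y hy
  have := b1 y' hy'
  omega

theorem caseA {V : Type*} [Fintype V] {R B : SimpleGraph V}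
    (hc : ∀ u v, u ≠ v → R.Adj u v ∨ B.Adj u v) {k l : ℕ} (hk : 2 ≤ k) (hl : 3 ≤ l) (hkl : k ≤ l)
    (hV : 2 * l + k - 1 ≤ Fintype.card V) (h : HasCyc B (2 * l - 1)) :
    HasCyc R (2 * k) ∨ HasCyc B (2 * l) := by
  classical
  rcases Nat.lt_or_ge k 3 with hk2 | hk3
  · have : k = 2 := by omega
    subst this
    exact caseA_two hc hl (by omega) h
  by_contra hcon
  have hodd : ¬ HasCyc B (2 * l + 1) := fun h => hcon (no_odd hc hk hkl (by omega) h)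
  rw [not_or] at hcon
  obtain ⟨hR, hBl⟩ := hcon
  obtain ⟨M, hM⟩ : ∃ M, M = 2 * l - 1 := ⟨_, rfl⟩
  have e1 : 2 * l = M + 1 := by omega
  rw [e1] at hBl hodd
  rw [← hM] at h
  have : NeZero M := ⟨by omega⟩
  obtain ⟨x, hx, hB⟩ := h
  obtain ⟨Y, hY, hYx⟩ := exists_outside x hx
  have bl : ∀ y ∈ Y, ∀ i, ¬ R.Adj y (x i) → B.Adj y (x i) :=
    fun y hy i => (hc y (x i) (hYx y hy i).symm).resolve_left
  refine hR (main_lemma hk3 (M := M) (by omega) hx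
    (fun y => Finset.univ.filter fun i => R.Adj y (x i)) (by simp) Y (by omega) hYx ?_ ?_)
  · intro y hy i
    simp only [Finset.mem_filter, Finset.mem_univ, true_and]
    by_contra hcon
    rw [not_or] at hcon
    exact hBl (ins1 (by omega) hx hB (hYx y hy) (bl y hy _ hcon.1) (bl y hy _ hcon.2))
  · intro y hy y' hy' hne i j hij
    simp only [Finset.mem_filter, Finset.mem_univ, true_and]
    intro h1 h2 h3 h4
    exact hodd ((cyc_cross hx hB hij (hYx y hy) (bl y hy _ h1) (bl y hy _ h2)).2 y' (hYx y' hy')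
      hne (bl y' hy' _ h3) (bl y' hy' _ h4))

/-- `k < l`: extend a blue cycle of length two less than `l + l`. -/
theorem caseB {V : Type*} [Fintype V] {R B : SimpleGraph V}
    (hc : ∀ u v, u ≠ v → R.Adj u v ∨ B.Adj u v) {k l : ℕ} (hk : 2 ≤ k) (hl : 3 ≤ l) (hkl : k < l)
    (hV : 2 * l + k - 1 ≤ Fintype.card V) (h : HasCyc B (2 * l - 2)) :
    HasCyc R (2 * k) ∨ HasCyc B (2 * l) := by
  classical
  by_cases hodd : HasCyc B (2 * l - 1)
  · exact caseA hc hk hl hkl.le hV hodd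
  by_contra hcon
  rw [not_or] at hcon
  obtain ⟨hR, hBl⟩ := hcon
  obtain ⟨M, hM⟩ : ∃ M, M = 2 * l - 2 := ⟨_, rfl⟩
  have e1 : 2 * l = M + 2 := by omega
  have e2 : 2 * l - 1 = M + 1 := by omega
  rw [e2] at hodd
  rw [e1] at hBl
  rw [← hM] at h
  have : NeZero M := ⟨by omega⟩
  obtain ⟨x, hx, hB⟩ := h
  obtain ⟨Y, hY, hYx⟩ := exists_outside x hx
  have bl : ∀ y ∈ Y, ∀ i, ¬ R.Adj y (x i) → B.Adj y (x i) :=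
    fun y hy i => (hc y (x i) (hYx y hy i).symm).resolve_left
  set A : V → Finset (ZMod M) := fun y => Finset.univ.filter fun i => R.Adj y (x i) with hA
  have memA : ∀ y i, i ∈ A y ↔ R.Adj y (x i) := by intro y i; simp [hA]
  have hI : ∀ y ∈ Y, ∀ i, i ∈ A y ∨ i + 1 ∈ A y := by
    intro y hy i
    simp only [memA]
    by_contra hcon
    rw [not_or] at hcon
    exact hodd (ins1 (by omega) hx hB (hYx y hy) (bl y hy _ hcon.1) (bl y hy _ hcon.2))
  have hX : ∀ y ∈ Y, ∀ y' ∈ Y, y ≠ y' → ∀ i j, i ≠ j → i ∉ A y → j ∉ A y → i + 1 ∉ A y' →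
      j + 1 ∉ A y' → False := by
    intro y hy y' hy' hne i j hij
    simp only [memA]
    intro h1 h2 h3 h4
    exact hBl ((cyc_cross hx hB hij (hYx y hy) (bl y hy _ h1) (bl y hy _ h2)).2 y' (hYx y' hy')
      hne (bl y' hy' _ h3) (bl y' hy' _ h4))
  rcases Nat.lt_or_ge k 3 with hk2 | hk3
  · have : k = 2 := by omega
    subst this
    have fin : ∀ y ∈ Y, ∀ y' ∈ Y, y ≠ y' → (A y ∩ A y').card < 2 := by
      intro y hy y' hy' hne
      by_contra hcon
      refine hR (two_common hx hne (A y ∩ A y') ?_ (not_lt.1 hcon))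
      intro i hi
      rwa [Finset.mem_inter, memA, memA] at hi
    obtain ⟨a, b, c, ha, hb, hc', hab, hac, hbc⟩ := Finset.two_lt_card_iff.1
      (show 2 < Y.card by omega)
    have f1 := fin a ha b hb hab
    have f2 := fin b hb c hc' hbc
    have f3 := fin a ha c hc' hac
    have p := pair_lower (A a) (A b) (hI a ha) (hI b hb) (hX a ha b hb hab)
      (hX b hb a ha hab.symm)
    have hM4 : M = 4 := by omega
    subst hM4
    have i1 := hI a ha
    have i2 := hI b hb
    have i3 := hI c hc'
    generalize A a = S1 at *
    generalize A b = S2 at *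
    generalize A c = S3 at *
    clear * - f1 f2 f3 i1 i2 i3
    have typ : ∀ S : Finset (ZMod 4), (∀ i, i ∈ S ∨ i + 1 ∈ S) → ({0, 2} ⊆ S ∨ {1, 3} ⊆ S) := by
      decide
    have big : ∀ (S T U : Finset (ZMod 4)), U.card = 2 → U ⊆ S → U ⊆ T → ¬ (S ∩ T).card < 2 := by
      intro S T U hU h1 h2
      have := Finset.card_le_card (Finset.subset_inter h1 h2)
      omega
    have c1 : ({0, 2} : Finset (ZMod 4)).card = 2 := by decide
    have c2 : ({1, 3} : Finset (ZMod 4)).card = 2 := by decide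
    rcases typ S1 i1 with t1 | t1 <;> rcases typ S2 i2 with t2 | t2 <;>
      rcases typ S3 i3 with t3 | t3 <;>
    first
    | exact big _ _ _ c1 t1 t2 f1
    | exact big _ _ _ c2 t1 t2 f1
    | exact big _ _ _ c1 t2 t3 f2
    | exact big _ _ _ c2 t2 t3 f2
    | exact big _ _ _ c1 t1 t3 f3
    | exact big _ _ _ c2 t1 t3 f3
  · exact hR (main_lemma hk3 (M := M) (by omega) hx A (by simp [hA]) Y (by omega) hYx hI hX)

theorem three_shift {M : ℕ} [NeZero M] (T : Finset (ZMod M)) (hM : 3 ≤ M)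
    (h1 : ∀ i, i ∉ T → i + 1 ∈ T) (h2 : ∀ i, i ∉ T → i + 2 ∈ T) : 3 * Tᶜ.card ≤ M := by
  classical
  set S := Tᶜ with hS
  set S1 := S.image (fun i => i + 1) with hS1
  set S2 := S.image (fun i => i + 2) with hS2
  have c1 : S1.card = S.card := Finset.card_image_of_injective _ (add_left_injective 1)
  have c2 : S2.card = S.card := Finset.card_image_of_injective _ (add_left_injective 2)
  have d12 : Disjoint S1 S2 := by
    rw [Finset.disjoint_left]
    intro a ha hb
    obtain ⟨i, hi, rfl⟩ := Finset.mem_image.1 ha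
    obtain ⟨j, hj, e⟩ := Finset.mem_image.1 hb
    have e : i = j + 1 := by
      have : j + 1 + 1 = i + 1 := by rw [← e]; ring
      exact (add_right_cancel this).symm
    rw [hS, Finset.mem_compl] at hi hj
    exact hi (e ▸ h1 j hj)
  have s1 : S1 ∪ S2 ⊆ T := by
    intro a ha
    rcases Finset.mem_union.1 ha with ha | ha
    · obtain ⟨i, hi, rfl⟩ := Finset.mem_image.1 ha
      exact h1 i (Finset.mem_compl.1 hi)
    · obtain ⟨i, hi, rfl⟩ := Finset.mem_image.1 ha
      exact h2 i (Finset.mem_compl.1 hi)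
  have := Finset.card_le_card s1
  rw [Finset.card_union_of_disjoint d12, c1, c2] at this
  have h3 := card_compl_zmod T
  rw [← hS] at h3
  omega

theorem caseB_eq {V : Type*} [Fintype V] {R B : SimpleGraph V}
    (hc : ∀ u v, u ≠ v → R.Adj u v ∨ B.Adj u v) {k : ℕ} (hk : 3 ≤ k)
    (hV : 3 * k - 1 ≤ Fintype.card V) (h : HasCyc B (2 * k - 2)) :
    HasCyc R (2 * k) ∨ HasCyc B (2 * k) := by
  classical
  by_cases hodd : HasCyc B (2 * k - 1)
  · exact caseA hc (by omega) hk le_rfl (by omega) hodd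
  by_cases hoddR : HasCyc R (2 * k - 1)
  · exact (caseA (fun u v h => (hc u v h).symm) (by omega) hk le_rfl (by omega) hoddR).symm
  by_contra hcon
  rw [not_or] at hcon
  obtain ⟨hR, hBl⟩ := hcon
  obtain ⟨M, hM⟩ : ∃ M, M = 2 * k - 2 := ⟨_, rfl⟩
  have e1 : 2 * k = M + 2 := by omega
  have e2 : 2 * k - 1 = M + 1 := by omega
  rw [e2] at hodd
  rw [e1] at hBl
  rw [← hM] at h
  have : NeZero M := ⟨by omega⟩
  have : NeZero k := ⟨by omega⟩
  obtain ⟨x, hx, hB⟩ := h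
  obtain ⟨Y, hY, hYx⟩ := exists_outside x hx
  have bl : ∀ y ∈ Y, ∀ i, ¬ R.Adj y (x i) → B.Adj y (x i) :=
    fun y hy i => (hc y (x i) (hYx y hy i).symm).resolve_left
  set A : V → Finset (ZMod M) := fun y => Finset.univ.filter fun i => R.Adj y (x i) with hA
  have memA : ∀ y i, i ∈ A y ↔ R.Adj y (x i) := by intro y i; simp [hA]
  have hA' : ∀ y, ∀ i ∈ A y, R.Adj y (x i) := fun y i h => (memA y i).1 h
  have hI : ∀ y ∈ Y, ∀ i, i ∈ A y ∨ i + 1 ∈ A y := by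
    intro y hy i
    simp only [memA]
    by_contra hcon
    rw [not_or] at hcon
    exact hodd (ins1 (by omega) hx hB (hYx y hy) (bl y hy _ hcon.1) (bl y hy _ hcon.2))
  have hX : ∀ y ∈ Y, ∀ y' ∈ Y, y ≠ y' → ∀ i j, i ≠ j → i ∉ A y → j ∉ A y → i + 1 ∉ A y' →
      j + 1 ∉ A y' → False := by
    intro y hy y' hy' hne i j hij
    simp only [memA]
    intro h1 h2 h3 h4
    exact hBl ((cyc_cross hx hB hij (hYx y hy) (bl y hy _ h1) (bl y hy _ h2)).2 y' (hYx y' hy')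
      hne (bl y' hy' _ h3) (bl y' hy' _ h4))
  have hpair : ∀ y ∈ Y, ∀ y' ∈ Y, y ≠ y' → k ≤ (A y ∩ A y').card + 2 := by
    intro y hy y' hy' hne
    have := pair_lower (A y) (A y') (hI y hy) (hI y' hy') (hX y hy y' hy' hne)
      (hX y' hy' y hy hne.symm)
    omega
  -- consequences of a blue pair outside
  have b1 : ∀ y ∈ Y, ∀ y' ∈ Y, B.Adj y y' → ∀ i, i ∉ A y → i + 1 ∈ A y' := by
    intro y hy y' hy' hb i h1
    by_contra h2
    rw [memA] at h1 h2
    exact hBl (ins2 (by omega) hx hB (hYx y hy) (hYx y' hy') hb (bl y hy _ h1) (bl y' hy' _ h2))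
  have b2 : ∀ y ∈ Y, ∀ y' ∈ Y, B.Adj y y' → ∀ i, i ∉ A y → i + 2 ∈ A y' := by
    intro y hy y' hy' hb i h1
    by_contra h2
    rw [memA] at h1 h2
    exact hodd (ins3 (by omega) hx hB (hYx y hy) (hYx y' hy') hb (bl y hy _ h1) (bl y' hy' _ h2))
  have b3 : ∀ y ∈ Y, ∀ y' ∈ Y, B.Adj y y' → k ≤ (A y ∩ A y').card + 1 := by
    intro y hy y' hy' hb
    have := ind_lower (A y ∩ A y') (by
      intro i
      by_contra hcon
      simp only [not_or, Finset.mem_inter] at hcon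
      have t1 := b1 y hy y' hy' hb i
      have t2 := b1 y' hy' y hy hb.symm i
      have t3 := hI y hy i
      have t4 := hI y' hy' i
      tauto)
    omega
  have hY3 : k + 1 ≤ Y.card := by omega
  by_cases hred : ∃ y₁ ∈ Y, ∃ y₂ ∈ Y, R.Adj y₁ y₂
  · obtain ⟨y₁, h1, y₂, h2, h12⟩ := hred
    have prop : ∀ y₁ ∈ Y, ∀ y₂ ∈ Y, R.Adj y₁ y₂ → ∀ y₃ ∈ Y, y₃ ≠ y₁ → y₃ ≠ y₂ →
        R.Adj y₂ y₃ := by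
      intro y₁ h1 y₂ h2 h12 y₃ h3 h31 h32
      obtain ⟨z, hz, hzY, z0, z1, z2⟩ := exists_listing hk Y (by omega) h1 h2 h3 h12.ne
        h32.symm h31.symm
      have q := (core2 hk hx A hA' Y hYx hpair hoddR (fun i => z (i + 1))
        (hz.comp (add_left_injective 1)) (fun i => hzY _) (by simpa [z0, z1] using h12)).2
      have e : (1 : ZMod k) + 1 = 2 := by norm_num
      simp only [zero_add, e, z1, z2] at q
      by_contra hcon
      have := b3 y₂ h2 y₃ h3 ((hc _ _ h32.symm).resolve_left hcon)
      omega
    have all : ∀ a ∈ Y, ∀ b ∈ Y, a ≠ b → R.Adj a b := by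
      have s1 : ∀ b ∈ Y, b ≠ y₂ → R.Adj y₂ b := by
        intro b hb hne
        by_cases hb1 : b = y₁
        · rw [hb1]; exact h12.symm
        · exact prop y₁ h1 y₂ h2 h12 b hb hb1 hne
      intro a ha b hb hab
      by_cases ha2 : a = y₂
      · rw [ha2]; exact s1 b hb (fun h => hab (ha2.trans h.symm))
      · have := s1 a ha ha2
        by_cases hb2 : b = y₂
        · rw [hb2]; exact this.symm
        · exact prop y₂ h2 a ha this b hb hb2 hab.symm
    have tri : ∀ a ∈ Y, ∀ b ∈ Y, ∀ c ∈ Y, a ≠ b → b ≠ c → a ≠ c →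
        A a ∩ A b = A b ∩ A c ∧ (A a ∩ A b).card = k - 2 := by
      intro a ha b hb c hc' hab hbc hac
      obtain ⟨z, hz, hzY, z0, z1, z2⟩ := exists_listing hk Y (by omega) ha hb hc' hab hbc hac
      have q := core2 hk hx A hA' Y hYx hpair hoddR z hz hzY (by
        refine all _ (hzY _) _ (hzY _) ?_
        intro h
        have h := hz h
        have : Fact (1 < k) := ⟨by omega⟩
        simp at h)
      rwa [z0, z1, z2] at q
    obtain ⟨a, b, c, ha, hb, hc', hab, hac, hbc⟩ := Finset.two_lt_card_iff.1
      (show 2 < Y.card by omega)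
    have t1 := tri a ha b hb c hc' hab hbc hac
    have t2 := tri b hb c hc' a ha hbc hac.symm hab.symm
    have := triple_lower (A a) (A b) (A c) (A a ∩ A b) (hI a ha) (hI b hb) (hI c hc') rfl
      t1.1.symm (t1.1.trans t2.1).symm
    omega
  · have blue : ∀ a ∈ Y, ∀ b ∈ Y, a ≠ b → B.Adj a b := by
      intro a ha b hb hab
      exact (hc a b hab).resolve_left fun h => hred ⟨a, ha, b, hb, h⟩
    have hpair' : ∀ y ∈ Y, ∀ y' ∈ Y, y ≠ y' → k ≤ (A y ∩ A y').card + 1 :=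
      fun y hy y' hy' hne => b3 y hy y' hy' (blue y hy y' hy' hne)
    obtain ⟨a, b, c, ha, hb, hc', hab, hac, hbc⟩ := Finset.two_lt_card_iff.1
      (show 2 < Y.card by omega)
    have t1 := core1 hk hx A hA' Y (by omega) hYx hpair' hR ha hb hc' hab hbc hac
    have t2 := core1 hk hx A hA' Y (by omega) hYx hpair' hR hb hc' ha hbc hac.symm hab.symm
    have m1 : ∀ i, i ∈ A a ∩ A b ↔ i ∈ A b ∩ A c := fun i => by rw [t1.1]
    have m2 : ∀ i, i ∈ A b ∩ A c ↔ i ∈ A c ∩ A a := fun i => by rw [t2.1]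
    simp only [Finset.mem_inter] at m1 m2
    have Bab := blue a ha b hb hab
    have Bbc := blue b hb c hc' hbc
    have Bac := blue a ha c hc' hac
    have gen : ∀ g : ZMod M → ZMod M, (∀ y ∈ Y, ∀ y' ∈ Y, B.Adj y y' → ∀ i, i ∉ A y → g i ∈ A y') →
        ∀ i, i ∉ A a ∩ A b → g i ∈ A a ∩ A b := by
      intro g hg i hi
      have g1 := hg a ha b hb Bab i
      have g2 := hg b hb a ha Bab.symm i
      have g3 := hg b hb c hc' Bbc i
      have g4 := hg c hc' b hb Bbc.symm i
      have g5 := hg a ha c hc' Bac i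
      have g6 := hg c hc' a ha Bac.symm i
      have n1 := m1 i
      have n2 := m2 i
      have n3 := m1 (g i)
      have n4 := m2 (g i)
      rw [Finset.mem_inter] at hi ⊢
      clear * - g1 g2 g3 g4 g5 g6 n1 n2 n3 n4 hi
      grind
    have q := three_shift (A a ∩ A b) (by omega) (gen (fun i => i + 1) b1) (gen (fun i => i + 2) b2)
    have := card_compl_zmod (A a ∩ A b)
    omega

theorem upper {k l : ℕ} (hk : 2 ≤ k) (hl : 3 ≤ l) (hkl : k ≤ l) :
    ∀ (V : Type) [Fintype V] (R B : SimpleGraph V), (∀ u v, u ≠ v → R.Adj u v ∨ B.Adj u v) →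
      2 * l + k - 1 ≤ Fintype.card V → HasCyc R (2 * k) ∨ HasCyc B (2 * l) := by
  induction l, hl using Nat.le_induction generalizing k with
  | base =>
    have two : ∀ (V : Type) [Fintype V] (R B : SimpleGraph V),
        (∀ u v, u ≠ v → R.Adj u v ∨ B.Adj u v) →
        7 ≤ Fintype.card V → HasCyc R 4 ∨ HasCyc B 6 := by
      intro V _ R B hc hV
      rcases base_four hc (by omega) with h | h
      · exact Or.inl h
      · exact caseB (k := 2) (l := 3) hc le_rfl le_rfl (by omega) (by omega) h
    intro V _ R B hc hV
    rcases Nat.lt_or_ge k 3 with hk2 | hk3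
    · obtain rfl : k = 2 := by omega
      exact two V R B hc (by omega)
    · obtain rfl : k = 3 := by omega
      rcases two V B R (fun u v h => (hc u v h).symm) (by omega) with h | h
      · exact caseB_eq hc le_rfl (by omega) h
      · exact Or.inl h
  | succ l hl ih =>
    have lt : ∀ k, 2 ≤ k → k ≤ l → ∀ (V : Type) [Fintype V] (R B : SimpleGraph V),
        (∀ u v, u ≠ v → R.Adj u v ∨ B.Adj u v) →
        2 * (l + 1) + k - 1 ≤ Fintype.card V → HasCyc R (2 * k) ∨ HasCyc B (2 * (l + 1)) := by
      intro k hk hkl V _ R B hc hV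
      rcases ih hk hkl V R B hc (by omega) with h | h
      · exact Or.inl h
      · exact caseB hc hk (by omega) (by omega) hV h
    intro V _ R B hc hV
    rcases Nat.lt_or_ge k (l + 1) with h' | h'
    · exact lt k hk (by omega) V R B hc hV
    · obtain rfl : k = l + 1 := by omega
      rcases lt l (by omega) le_rfl V B R (fun u v h => (hc u v h).symm) (by omega) with h | h
      · exact caseB_eq hc (by omega) (by omega) h
      · exact Or.inl h

theorem emb_of_hasCyc {V : Type} {G : SimpleGraph V} {m : ℕ} (hm : 3 ≤ m) (h : HasCyc G m) :
    ∃ f : Fin m ↪ V, ∀ u v, (cycleGraph m).Adj u v → G.Adj (f u) (f v) := by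
  obtain ⟨n, rfl⟩ : ∃ n, m = n + 2 := ⟨m - 2, by omega⟩
  obtain ⟨f, hf, hadj⟩ := h
  have hadj' : ∀ i : Fin (n + 2), G.Adj (f i) (f (i + 1 : Fin (n + 2))) := hadj
  refine ⟨⟨fun i : Fin (n + 2) => f i, fun a b h => hf h⟩, ?_⟩
  intro u v huv
  rw [cycleGraph_adj] at huv
  rcases huv with h | h
  · have : u = v + 1 := by rw [← h]; abel
    rw [this]
    exact (hadj' v).symm
  · have : v = u + 1 := by rw [← h]; abel
    rw [this]
    exact hadj' u

theorem upper_ramsey {k l : ℕ} (hk : 2 ≤ k) (hl : 3 ≤ l) (hkl : k ≤ l) :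
    RamseyProp (cycleGraph (2 * k)) (cycleGraph (2 * l)) (2 * l + k - 1) := by
  intro c
  let R : SimpleGraph (Fin (2 * l + k - 1)) :=
    { Adj := fun u v => u ≠ v ∧ c s(u, v) = 0
      symm := ⟨fun u v h => ⟨h.1.symm, by rw [Sym2.eq_swap]; exact h.2⟩⟩
      loopless := ⟨fun u h => h.1 rfl⟩ }
  let B : SimpleGraph (Fin (2 * l + k - 1)) :=
    { Adj := fun u v => u ≠ v ∧ c s(u, v) = 1
      symm := ⟨fun u v h => ⟨h.1.symm, by rw [Sym2.eq_swap]; exact h.2⟩⟩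
      loopless := ⟨fun u h => h.1 rfl⟩ }
  have hc : ∀ u v, u ≠ v → R.Adj u v ∨ B.Adj u v := by
    intro u v h
    have : ∀ a : Fin 2, a = 0 ∨ a = 1 := by decide
    rcases this (c s(u, v)) with h' | h'
    · exact Or.inl ⟨h, h'⟩
    · exact Or.inr ⟨h, h'⟩
  rcases upper hk hl hkl _ R B hc (by simp) with h | h
  · obtain ⟨f, hf⟩ := emb_of_hasCyc (by omega) h
    exact Or.inl ⟨f, fun u v h => (hf u v h).2⟩
  · obtain ⟨f, hf⟩ := emb_of_hasCyc (by omega) h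
    exact Or.inr ⟨f, fun u v h => (hf u v h).2⟩

theorem cycle_succ {m : ℕ} (i : ℕ) (hi : i + 1 < m) :
    (cycleGraph m).Adj ⟨i, by omega⟩ ⟨i + 1, hi⟩ := by
  obtain ⟨n, rfl⟩ : ∃ n, m = n + 2 := ⟨m - 2, by omega⟩
  rw [cycleGraph_adj]
  right
  rw [sub_eq_iff_eq_add]
  ext
  rw [Fin.val_add, Fin.val_one, Nat.mod_eq_of_lt (by simp only; omega)]
  simp only
  omega

theorem lower_ramsey {k l N : ℕ} (hk : 2 ≤ k) (hl : 3 ≤ l) (hN : N < 2 * l + k - 1) :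
    ¬ RamseyProp (cycleGraph (2 * k)) (cycleGraph (2 * l)) N := by
  classical
  intro h
  rcases h (fun e => if ∃ v ∈ e, 2 * l - 1 ≤ v.val then 0 else 1) with ⟨f, hf⟩ | ⟨f, hf⟩
  · have key : ∀ i : Fin k, ∃ b : Fin 2, 2 * l - 1 ≤ (f ⟨2 * i.val + b.val, by omega⟩).val := by
      intro i
      have := hf _ _ (cycle_succ (m := 2 * k) (2 * i.val) (by omega))
      simp only [ite_eq_left_iff, one_ne_zero, imp_false, not_not] at this
      obtain ⟨v, hv, hv'⟩ := this
      rcases Sym2.mem_iff.1 hv with rfl | rfl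
      · exact ⟨0, hv'⟩
      · exact ⟨1, hv'⟩
    choose b hb using key
    have lt : ∀ i : Fin k, (f ⟨2 * i.val + (b i).val, by omega⟩).val - (2 * l - 1) < k - 1 := by
      intro i
      have := hb i
      have := (f ⟨2 * i.val + (b i).val, by omega⟩).isLt
      omega
    have inj : Function.Injective (fun i : Fin k => (⟨_, lt i⟩ : Fin (k - 1))) := by
      intro i j hij
      simp only [Fin.mk.injEq] at hij
      have h1 := hb i
      have h2 := hb j
      have e : f ⟨2 * i.val + (b i).val, by omega⟩ = f ⟨2 * j.val + (b j).val, by omega⟩ := by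
        ext; omega
      have e := f.injective e
      simp only [Fin.mk.injEq] at e
      ext
      omega
    have := Fintype.card_le_of_injective _ inj
    simp at this
    omega
  · have lt : ∀ i : Fin (2 * l), (f i).val < 2 * l - 1 := by
      intro i
      obtain ⟨j, hj⟩ : ∃ j, (cycleGraph (2 * l)).Adj i j := by
        by_cases hi : i.val + 1 < 2 * l
        · exact ⟨_, cycle_succ i.val hi⟩
        · have := cycle_succ (m := 2 * l) (i.val - 1) (by omega)
          have e : (⟨i.val - 1 + 1, by omega⟩ : Fin (2 * l)) = i := by ext; simp only; omega
          rw [e] at this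
          exact ⟨_, this.symm⟩
      have := hf _ _ hj
      simp only [ite_eq_right_iff, zero_ne_one, imp_false] at this
      by_contra hcon
      exact this ⟨f i, Sym2.mem_mk_left _ _, by omega⟩
    have inj : Function.Injective (fun i : Fin (2 * l) => (⟨_, lt i⟩ : Fin (2 * l - 1))) := by
      intro i j hij
      simp only [Fin.mk.injEq] at hij
      exact f.injective (Fin.ext hij)
    have := Fintype.card_le_of_injective _ inj
    simp at this
    omega

theorem ramsey_cycles_even_even (m n : ℕ) (hm : 4 ≤ m) (hmn : m ≤ n)
    (hme : Even m) (hne' : Even n) (hne : (m, n) ≠ (4, 4)) :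
    ramseyNumber (cycleGraph m) (cycleGraph n) = n - 1 + m / 2 := by
  obtain ⟨k, rfl⟩ := hme
  obtain ⟨l, rfl⟩ := hne'
  rw [← two_mul] at *
  rw [← two_mul] at *
  have hl : 3 ≤ l := by
    by_contra hcon
    have h1 : k = 2 := by omega
    have h2 : l = 2 := by omega
    subst h1 h2
    exact hne rfl
  have e : 2 * l - 1 + 2 * k / 2 = 2 * l + k - 1 := by omega
  rw [e]
  have hk : 2 ≤ k := by omega
  have up := upper_ramsey hk hl (by omega)
  apply le_antisymm
  · exact Nat.sInf_le up
  · by_contra hcon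
    exact lower_ramsey hk hl (not_le.1 hcon) (Nat.sInf_mem (s := {N | RamseyProp (cycleGraph (2 * k)) (cycleGraph (2 * l)) N}) ⟨_, up⟩)
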